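/- arXiv:1601.06110 — 4 statements merged into one kernel-verified Lean document; each statement's English description precedes it below -/
import Mathlib

section
/- For every n, k ∈ ℕ the q-binomial coefficient polynomial satisfies B_q(k) evaluated at [n]_q equals the Gaussian binomial qbinom(n,k). Moreover, a polynomial P ∈ K[x] satisfies P([n]_q) ∈ ℤ[q] for all n ∈ ℕ if and only if P lies in the ℤ[q]-linear span of the polynomials B_q(k), k ∈ ℕ, and the family (B_q(k))_{k ∈ ℕ} is linearly independent over ℤ[q]. (Thus the ring R_q^+ of quantum integer-valued polynomials is freely generated as a ℤ[q]-module by the B_q(k).) -/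
open Polynomial

noncomputable section

/-- `K = ℚ(q)`, the field of rational functions in `q` over `ℚ`. -/
abbrev K : Type := RatFunc ℚ

/-- The variable `q ∈ K`. -/
def qq : K := RatFunc.X

/-- The quantum integer `[n]_q = (q^n - 1)/(q - 1) ∈ K`, for `n ∈ ℤ`. -/
def qInt (n : ℤ) : K := (qq ^ n - 1) / (qq - 1)

/-- The quantum factorial `[n]_q! = ∏_{i=1}^n [i]_q`. -/
def qFact (n : ℕ) : K := ∏ i ∈ Finset.range n, qInt ((i : ℤ) + 1)

/-- The Gaussian binomial coefficient `qbinom(n,k) ∈ K`. -/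
def qBinom (n k : ℕ) : K := if k ≤ n then qFact n / (qFact k * qFact (n - k)) else 0

/-- The `q`-binomial coefficient polynomial
`B_q(k) = x(x-[1]_q)⋯(x-[k-1]_q)/(q^{C(k,2)}·[k]_q!) ∈ K[x]`, with `B_q(0) = 1`. -/
def Bq (k : ℕ) : K[X] :=
  C ((qq ^ (k.choose 2) * qFact k)⁻¹) * ∏ i ∈ Finset.range k, (X - C (qInt i))

/-- The subring `ℤ[q]` of `K`. -/
def Zq : Subring K := Subring.closure {qq}

theorem qq_ne_zero : qq ≠ 0 := RatFunc.X_ne_zero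

theorem qq_pow_ne_one (n : ℕ) (hn : n ≠ 0) : qq ^ n ≠ 1 := by
  intro h
  have h2 : algebraMap ℚ[X] (RatFunc ℚ) (X ^ n) = algebraMap ℚ[X] (RatFunc ℚ) 1 := by
    rw [map_pow, RatFunc.algebraMap_X, map_one]; exact h
  have h3 := RatFunc.algebraMap_injective ℚ h2
  have h4 := congrArg natDegree h3
  simp at h4
  exact hn h4

theorem qq_sub_one_ne : qq - 1 ≠ 0 := by
  have := qq_pow_ne_one 1 one_ne_zero
  rw [pow_one] at this
  exact sub_ne_zero.2 this

theorem qInt_nat (n : ℕ) : qInt (n : ℤ) = (qq ^ n - 1) / (qq - 1) := by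
  simp [qInt]

theorem qInt_nat_succ (n : ℕ) : qInt ((n : ℤ) + 1) = (qq ^ (n + 1) - 1) / (qq - 1) := by
  have := qInt_nat (n + 1)
  push_cast at this
  exact this

theorem qInt_succ_ne (n : ℕ) : qInt ((n : ℤ) + 1) ≠ 0 := by
  rw [qInt_nat_succ]
  exact div_ne_zero (sub_ne_zero.2 (qq_pow_ne_one _ (Nat.succ_ne_zero n))) qq_sub_one_ne

theorem qFact_succ (n : ℕ) : qFact (n + 1) = qFact n * qInt ((n : ℤ) + 1) :=
  Finset.prod_range_succ _ _

theorem qFact_ne (n : ℕ) : qFact n ≠ 0 :=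
  Finset.prod_ne_zero_iff.2 fun i _ => qInt_succ_ne i

theorem qInt_sub (m i : ℕ) :
    qInt ((m + 1 + i : ℕ) : ℤ) - qInt (i : ℤ) = qq ^ i * qInt ((m : ℤ) + 1) := by
  rw [qInt_nat, qInt_nat, qInt_nat_succ]
  ring

theorem qInt_nat_injective : Function.Injective fun n : ℕ => qInt (n : ℤ) := by
  have key : ∀ m i : ℕ, qInt ((m + 1 + i : ℕ) : ℤ) ≠ qInt (i : ℤ) := fun m i =>
    sub_ne_zero.1 (by
      rw [qInt_sub]
      exact mul_ne_zero (pow_ne_zero _ qq_ne_zero) (qInt_succ_ne m))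
  intro a b h
  rcases lt_trichotomy a b with h1 | h1 | h1
  · obtain ⟨c, rfl⟩ := Nat.exists_eq_add_of_lt h1
    refine absurd h.symm ?_
    have := key c a
    rwa [show c + 1 + a = a + c + 1 by ring] at this
  · exact h1
  · obtain ⟨c, rfl⟩ := Nat.exists_eq_add_of_lt h1
    refine absurd h ?_
    have := key c b
    rwa [show c + 1 + b = b + c + 1 by ring] at this

theorem prod_qInt_sub (k : ℕ) : ∀ m : ℕ,
    (∏ i ∈ Finset.range k, (qInt ((m + k : ℕ) : ℤ) - qInt (i : ℤ))) * qFact m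
      = qq ^ (k.choose 2) * qFact (m + k) := by
  induction k with
  | zero => intro m; simp
  | succ k ih =>
    intro m
    have h := ih (m + 1)
    rw [show m + 1 + k = m + (k + 1) by ring, qFact_succ] at h
    rw [Finset.prod_range_succ]
    have h2 := qInt_sub m k
    rw [show m + 1 + k = m + (k + 1) by ring] at h2
    rw [h2, Nat.choose_succ_succ' k 1, Nat.choose_one_right, pow_add]
    linear_combination (qq ^ k) * h

theorem eval_Bq (n k : ℕ) : (Bq k).eval (qInt (n : ℤ)) = qBinom n k := by
  unfold Bq qBinom
  rw [eval_mul, eval_C, eval_prod]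
  simp only [eval_sub, eval_X, eval_C]
  split_ifs with h
  · obtain ⟨m, rfl⟩ := Nat.exists_eq_add_of_le' h
    have := prod_qInt_sub k m
    rw [Nat.add_sub_cancel]
    have h1 := qFact_ne k
    have h2 := qFact_ne m
    have h3 := pow_ne_zero (k.choose 2) qq_ne_zero
    field_simp
    linear_combination this
  · rw [Finset.prod_eq_zero (i := n) (Finset.mem_range.2 (not_le.1 h)) (sub_self _), mul_zero]

theorem qBinom_zero (n : ℕ) : qBinom n 0 = 1 := by
  have := qFact_ne n
  simp [qBinom, this, show qFact 0 = 1 from rfl]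

theorem qBinom_self (n : ℕ) : qBinom n n = 1 := by
  have := qFact_ne n
  simp [qBinom, this, show qFact 0 = 1 from rfl]

theorem qBinom_succ (n k : ℕ) :
    qBinom (n + 1) (k + 1) = qBinom n k + qq ^ (k + 1) * qBinom n (k + 1) := by
  rcases lt_trichotomy n k with h | rfl | h
  · simp [qBinom, not_le.2 h, show ¬ (k + 1 ≤ n) by omega]
  · rw [qBinom_self, qBinom_self]
    simp [qBinom]
  · obtain ⟨m, rfl⟩ := Nat.exists_eq_add_of_lt h
    unfold qBinom
    rw [if_pos (by omega), if_pos (by omega), if_pos (by omega),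
      show k + m + 1 + 1 - (k + 1) = m + 1 by omega, show k + m + 1 - k = m + 1 by omega,
      show k + m + 1 - (k + 1) = m by omega, qFact_succ (k + m + 1), qFact_succ m, qFact_succ k]
    have h1 := qFact_ne k
    have h2 := qFact_ne m
    have h3 := qInt_succ_ne k
    have h4 := qInt_succ_ne m
    have h5 : qInt (((k + m + 1 : ℕ) : ℤ) + 1)
        = qInt ((k : ℤ) + 1) + qq ^ (k + 1) * qInt ((m : ℤ) + 1) := by
      rw [qInt_nat_succ, qInt_nat_succ, qInt_nat_succ]
      ring
    rw [h5]
    generalize qInt ((k : ℤ) + 1) = a at *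
    generalize qInt ((m : ℤ) + 1) = b at *
    field_simp

theorem qq_mem : qq ∈ Zq := Subring.subset_closure rfl

theorem qBinom_mem (n : ℕ) : ∀ k, qBinom n k ∈ Zq := by
  induction n with
  | zero =>
    intro k
    cases k with
    | zero => rw [qBinom_zero]; exact one_mem _
    | succ k => simp [qBinom, zero_mem]
  | succ n ih =>
    intro k
    cases k with
    | zero => rw [qBinom_zero]; exact one_mem _
    | succ k =>
      rw [qBinom_succ]
      exact add_mem (ih k) (mul_mem (pow_mem qq_mem _) (ih _))

theorem eval_mem_of_span (P : K[X]) (hP : P ∈ Submodule.span (↥Zq) (Set.range Bq)) (n : ℕ) :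
    P.eval (qInt (n : ℤ)) ∈ Zq := by
  induction hP using Submodule.span_induction with
  | mem x h =>
    obtain ⟨k, rfl⟩ := h
    rw [eval_Bq]
    exact qBinom_mem n k
  | zero => simp [zero_mem]
  | add x y _ _ hx hy => rw [eval_add]; exact add_mem hx hy
  | smul a x _ hx =>
    have : a • x = C (a : K) * x := by
      rw [← smul_eq_C_mul]; rfl
    rw [this, eval_mul, eval_C]
    exact mul_mem a.2 hx

theorem degree_Bq (k : ℕ) : (Bq k).degree = k := by
  unfold Bq
  rw [degree_C_mul (inv_ne_zero (mul_ne_zero (pow_ne_zero _ qq_ne_zero) (qFact_ne k))),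
    degree_prod]
  simp

theorem exists_interp (P : K[X]) (hP : ∀ n : ℕ, P.eval (qInt (n : ℤ)) ∈ Zq) (N : ℕ) :
    ∃ Q ∈ Submodule.span (↥Zq) (Set.range Bq), Q.degree < (N : WithBot ℕ) ∧
      ∀ j < N, Q.eval (qInt (j : ℤ)) = P.eval (qInt (j : ℤ)) := by
  induction N with
  | zero => exact ⟨0, zero_mem _, by simp, by simp⟩
  | succ N ih =>
    obtain ⟨Q, hQ, hd, he⟩ := ih
    let c : Zq := ⟨P.eval (qInt (N : ℤ)) - Q.eval (qInt (N : ℤ)),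
      sub_mem (hP N) (eval_mem_of_span Q hQ N)⟩
    have hc : c • Bq N = C (c : K) * Bq N := by
      rw [← smul_eq_C_mul]; rfl
    refine ⟨Q + c • Bq N,
      add_mem hQ (Submodule.smul_mem _ _ (Submodule.subset_span ⟨N, rfl⟩)), ?_, ?_⟩
    · have hN : (N : WithBot ℕ) < ((N + 1 : ℕ) : WithBot ℕ) := by
        exact_mod_cast Nat.lt_succ_self N
      refine lt_of_le_of_lt (degree_add_le _ _) (max_lt (hd.trans hN) ?_)
      rw [hc, ← smul_eq_C_mul]
      exact lt_of_le_of_lt (degree_smul_le _ _) (by rw [degree_Bq]; exact hN)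
    · intro j hj
      rw [hc, eval_add, eval_mul, eval_C, eval_Bq]
      rcases Nat.lt_succ_iff_lt_or_eq.1 hj with h | rfl
      · rw [he j h]
        simp [qBinom, not_le.2 h]
      · rw [qBinom_self]
        simp [c]

theorem mem_span_of_eval (P : K[X]) (hP : ∀ n : ℕ, P.eval (qInt (n : ℤ)) ∈ Zq) :
    P ∈ Submodule.span (↥Zq) (Set.range Bq) := by
  obtain ⟨Q, hQ, hd, he⟩ := exists_interp P hP (P.natDegree + 1)
  have : Q = P := by
    refine Polynomial.eq_of_degrees_lt_of_eval_index_eq (Finset.range (P.natDegree + 1))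
      (v := fun n : ℕ => qInt (n : ℤ)) qInt_nat_injective.injOn ?_ ?_ ?_
    · simpa using hd
    · rw [Finset.card_range]
      exact lt_of_le_of_lt degree_le_natDegree (by exact_mod_cast Nat.lt_succ_self _)
    · intro j hj
      exact he j (Finset.mem_range.1 hj)
  exact this ▸ hQ

theorem Bq_indep : LinearIndependent K Bq :=
  Polynomial.Sequence.linearIndependent (R := K) ⟨Bq, degree_Bq⟩

/-- `B_q(k)` evaluates at `[n]_q` to the Gaussian binomial `qbinom(n,k)`; a polynomial
`P ∈ K[x]` satisfies `P([n]_q) ∈ ℤ[q]` for all `n ∈ ℕ` iff it lies in the `ℤ[q]`-linear span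
of the `B_q(k)`; and the `B_q(k)` are linearly independent over `ℤ[q]`. -/
theorem quantum_integer_valued_iff_mem_span_qbinomial :
    (∀ n k : ℕ, (Bq k).eval (qInt (n : ℤ)) = qBinom n k) ∧
    (∀ P : K[X], (∀ n : ℕ, P.eval (qInt (n : ℤ)) ∈ Zq) ↔
      P ∈ Submodule.span (↥Zq) (Set.range Bq)) ∧
    LinearIndependent (↥Zq) Bq := by
  exact ⟨eval_Bq, fun P => ⟨mem_span_of_eval P, fun h n => eval_mem_of_span P h n⟩,
    Bq_indep.restrict_scalars' (↥Zq)⟩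
end
end

section
/- Let p be a prime. There exists a ring homomorphism Ψ_p : R ⊗_ℤ (ℤ/pℤ) → R ⊗_ℤ (ℤ/pℤ) such that Ψ_p(B(k) ⊗ 1) = B(pk) ⊗ 1 for all k ∈ ℕ. (Here R ⊗_ℤ (ℤ/pℤ) denotes the base change of the ring R of integer-valued polynomials to the field with p elements; equivalently Ψ_p is the ℤ/pℤ-linear map defined on the basis by B(k) ↦ B(pk), and the claim is that it is multiplicative.) -/
open Polynomial TensorProduct

noncomputable section

/-- The binomial coefficient polynomial `B k = x(x-1)⋯(x-k+1)/k! ∈ ℚ[x]`, with `B 0 = 1`. -/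
def B (k : ℕ) : ℚ[X] :=
  C ((k.factorial : ℚ)⁻¹) * ∏ i ∈ Finset.range k, (X - C (i : ℚ))

/-- The ring `R` of integer-valued polynomials, as a subring of `ℚ[x]`. -/
def Rring : Subring ℚ[X] where
  carrier := {P | ∀ n : ℕ, ∃ z : ℤ, P.eval (n : ℚ) = (z : ℚ)}
  mul_mem' := by
    rintro a b ha hb n
    obtain ⟨za, hza⟩ := ha n
    obtain ⟨zb, hzb⟩ := hb n
    exact ⟨za * zb, by simp [hza, hzb]⟩
  one_mem' := fun n => ⟨1, by simp⟩
  add_mem' := by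
    rintro a b ha hb n
    obtain ⟨za, hza⟩ := ha n
    obtain ⟨zb, hzb⟩ := hb n
    exact ⟨za + zb, by simp [hza, hzb]⟩
  zero_mem' := fun n => ⟨0, by simp⟩
  neg_mem' := by
    rintro a ha n
    obtain ⟨za, hza⟩ := ha n
    exact ⟨-za, by simp [hza]⟩

theorem B_eval (k n : ℕ) : (B k).eval (n : ℚ) = (n.choose k : ℚ) := by
  have h1 := descPochhammer_eval_eq_prod_range (R := ℚ) k (n : ℚ)
  have h2 := descPochhammer_eval_eq_descFactorial ℚ n k
  have hk : (k.factorial : ℚ) ≠ 0 := by exact_mod_cast k.factorial_ne_zero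
  have h3 : (n.descFactorial k : ℚ) = k.factorial * n.choose k := by
    exact_mod_cast Nat.descFactorial_eq_factorial_mul_choose n k
  simp only [B, eval_mul, eval_C, eval_prod, eval_sub, eval_X]
  rw [← h1, h2, h3, inv_mul_cancel_left₀ hk]

/-- Binomial polynomial as an element of the ring. -/
def BR (k : ℕ) : Rring := ⟨B k, fun n => ⟨n.choose k, by simp [B_eval]⟩⟩

/-- Integer values. -/
def evZ (r : Rring) (n : ℕ) : ℤ := (r.2 n).choose

theorem evZ_spec (r : Rring) (n : ℕ) : (r : ℚ[X]).eval (n : ℚ) = (evZ r n : ℚ) :=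
  (r.2 n).choose_spec

theorem evZ_eq {r : Rring} {n : ℕ} {z : ℤ} (h : (r : ℚ[X]).eval (n : ℚ) = (z : ℚ)) :
    evZ r n = z := by
  rw [evZ_spec] at h
  exact_mod_cast h

/-- Evaluation as a ring homomorphism. -/
def evHom : Rring →+* (ℕ → ℤ) where
  toFun := evZ
  map_one' := by funext n; apply evZ_eq; simp
  map_zero' := by funext n; apply evZ_eq; simp
  map_mul' a b := by funext n; apply evZ_eq; simp [evZ_spec]
  map_add' a b := by funext n; apply evZ_eq; simp [evZ_spec]

theorem evHom_BR (k n : ℕ) : evHom (BR k) n = n.choose k := by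
  apply evZ_eq; simp [BR, B_eval]

theorem newton (r : Rring) : ∃ (D : ℕ) (c : ℕ → ℤ), ∀ n : ℕ,
    evHom r n = ∑ k ∈ Finset.range D, c k * (n.choose k : ℤ) := by
  have hc : ∀ k : ℕ, ∃ z : ℤ,
      (fwdDiff (1 : ℚ))^[k] (fun x => (r : ℚ[X]).eval x) 0 = (z : ℚ) := by
    intro k
    rw [fwdDiff_iter_eq_sum_shift]
    refine ⟨∑ j ∈ Finset.range (k + 1), ((-1) ^ (k - j) * (k.choose j : ℤ)) * evZ r j, ?_⟩
    push_cast
    refine Finset.sum_congr rfl fun j _ => ?_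
    have := evZ_spec r j
    simp [this]
  choose c hc using hc
  have hv : ∀ k, (r : ℚ[X]).natDegree < k → c k = 0 := by
    intro k hk
    have := hc k
    rw [Polynomial.fwdDiff_iter_eq_zero_of_degree_lt hk, Pi.zero_apply] at this
    exact_mod_cast this.symm
  refine ⟨(r : ℚ[X]).natDegree + 1, c, fun n => ?_⟩
  have h1 := shift_eq_sum_fwdDiff_iter (1 : ℚ) (fun x => (r : ℚ[X]).eval x) n 0
  simp only [hc, zero_add, nsmul_eq_mul, mul_one] at h1
  rw [evZ_spec] at h1
  have h2 : evZ r n = ∑ k ∈ Finset.range (n + 1), c k * (n.choose k : ℤ) := by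
    have : evZ r n = ∑ k ∈ Finset.range (n + 1), (n.choose k : ℤ) * c k := by
      exact_mod_cast h1
    rw [this]
    exact Finset.sum_congr rfl fun j _ => mul_comm _ _
  change evZ r n = _
  rw [h2]
  set d := (r : ℚ[X]).natDegree
  trans ∑ k ∈ Finset.range (max (n + 1) (d + 1)), c k * (n.choose k : ℤ)
  · apply Finset.sum_subset
    · intro x; simp; omega
    · intro x _ hx
      rw [Nat.choose_eq_zero_of_lt (by simpa using hx)]; simp
  · symm
    apply Finset.sum_subset
    · intro x; simp; omega
    · intro x _ hx
      rw [hv x (by simpa using hx)]; simp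

theorem lucas_mul (p : ℕ) (hp : p.Prime) (n k : ℕ) :
    ((n.choose (p * k) : ℕ) : ZMod p) = ((n / p).choose k : ℕ) := by
  have := Fact.mk hp
  have h := Choose.choose_modEq_choose_mod_mul_choose_div_nat (n := n) (k := p * k) (p := p)
  rw [← ZMod.natCast_eq_natCast_iff] at h
  rw [h, Nat.mul_mod_right, Nat.mul_div_cancel_left _ hp.pos]
  simp

/-- Reduction modulo `p` of the evaluation homomorphism. -/
def evMod (p : ℕ) : (↥Rring ⊗[ℤ] ZMod p) →ₐ[ℤ] (ℕ → ZMod p) :=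
  Algebra.TensorProduct.productMap
    (((Int.castRingHom (ZMod p)).compLeft ℕ).comp evHom).toIntAlgHom
    (Pi.constRingHom ℕ (ZMod p)).toIntAlgHom

theorem evMod_tmul (p : ℕ) (r : Rring) (n : ℕ) :
    evMod p (r ⊗ₜ 1) n = (evHom r n : ZMod p) := by
  have h : evMod p (r ⊗ₜ 1) = (((Int.castRingHom (ZMod p)).compLeft ℕ).comp evHom) r *
      (Pi.constRingHom ℕ (ZMod p)) 1 :=
    Algebra.TensorProduct.productMap_apply_tmul _ _ _ _
  rw [h, map_one, mul_one]
  rfl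

theorem exists_tmul (p : ℕ) (x : ↥Rring ⊗[ℤ] ZMod p) : ∃ r : Rring, x = r ⊗ₜ 1 := by
  induction x with
  | zero => exact ⟨0, by simp⟩
  | add a b ha hb =>
    obtain ⟨r, rfl⟩ := ha
    obtain ⟨s, rfl⟩ := hb
    exact ⟨r + s, by rw [TensorProduct.add_tmul]⟩
  | tmul r z =>
    obtain ⟨m, rfl⟩ := ZMod.intCast_surjective z
    refine ⟨m • r, ?_⟩
    rw [TensorProduct.smul_tmul]
    simp

theorem evMod_injective (p : ℕ) (hp : p.Prime) : Function.Injective (evMod p) := by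
  rw [injective_iff_map_eq_zero]
  intro x hx
  obtain ⟨r, rfl⟩ := exists_tmul p x
  have hpq : (p : ℚ) ≠ 0 := by exact_mod_cast hp.ne_zero
  have hd : ∀ n, (p : ℤ) ∣ evZ r n := by
    intro n
    rw [← ZMod.intCast_zmod_eq_zero_iff_dvd]
    have := congrFun hx n
    rw [evMod_tmul] at this
    exact this
  let s : Rring := ⟨C ((p : ℚ)⁻¹) * r, fun n => by
    obtain ⟨z, hz⟩ := hd n
    refine ⟨z, ?_⟩
    rw [eval_mul, eval_C, evZ_spec, hz]
    push_cast
    rw [inv_mul_cancel_left₀ hpq]⟩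
  have hs : r = (p : ℤ) • s := by
    apply Subtype.ext
    have h : ((p : ℤ) • s : Rring) = (p : Rring) * s := by simp
    rw [h]
    simp only [s, Subring.coe_mul, Subring.coe_natCast]
    rw [← mul_assoc, ← C_eq_natCast, ← C_mul, mul_inv_cancel₀ hpq, C_1, one_mul]
  rw [hs, TensorProduct.smul_tmul]
  simp

theorem exists_lift (p : ℕ) (hp : p.Prime) (x : ↥Rring ⊗[ℤ] ZMod p) :
    ∃ y, ∀ n, evMod p y n = evMod p x (n / p) := by
  obtain ⟨r, rfl⟩ := exists_tmul p x
  obtain ⟨D, c, h⟩ := newton r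
  refine ⟨(∑ k ∈ Finset.range D, (c k : Rring) * BR (p * k)) ⊗ₜ 1, fun n => ?_⟩
  rw [evMod_tmul, evMod_tmul, h, map_sum, Finset.sum_apply]
  push_cast
  refine Finset.sum_congr rfl fun k _ => ?_
  rw [map_mul, Pi.mul_apply, evHom_BR, map_intCast]
  simp [lucas_mul p hp]

/-- For every prime `p` there is a ring homomorphism (the Frobenius map)
`Ψ_p : R ⊗_ℤ ℤ/pℤ → R ⊗_ℤ ℤ/pℤ` with `Ψ_p(B(k) ⊗ 1) = B(pk) ⊗ 1` for all `k`. -/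
theorem exists_frobenius (p : ℕ) (hp : p.Prime) :
    ∃ Ψ : (↥Rring ⊗[ℤ] ZMod p) →+* (↥Rring ⊗[ℤ] ZMod p),
      ∀ (k : ℕ) (Bk Bpk : ↥Rring), (Bk : ℚ[X]) = B k → (Bpk : ℚ[X]) = B (p * k) →
        Ψ (Bk ⊗ₜ[ℤ] (1 : ZMod p)) = Bpk ⊗ₜ[ℤ] (1 : ZMod p) := by
  choose f hf using exists_lift p hp
  have inj : ∀ a b, (∀ n, evMod p a n = evMod p b n) → a = b := fun a b h =>
    evMod_injective p hp (funext h)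
  refine ⟨{ toFun := f, map_one' := ?_, map_zero' := ?_, map_mul' := ?_, map_add' := ?_ }, ?_⟩
  · apply inj; intro n; rw [hf]; simp
  · intro a b; apply inj; intro n; simp [hf]
  · apply inj; intro n; rw [hf]; simp
  · intro a b; apply inj; intro n; simp [hf]
  · intro k Bk Bpk h1 h2
    obtain rfl : Bk = BR k := Subtype.ext h1
    obtain rfl : Bpk = BR (p * k) := Subtype.ext h2
    apply inj
    intro n
    change evMod p (f _) n = _
    rw [hf, evMod_tmul, evMod_tmul, evHom_BR, evHom_BR]
    have := lucas_mul p hp n k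
    simp [this]
end
end

section
/- Let p be a prime. Let τ : R → R be the ring homomorphism τ(P) := P composed with (−1 − x) (this preserves R since it sends integer values to integer values), and let τ̄ : R ⊗_ℤ (ℤ/pℤ) → R ⊗_ℤ (ℤ/pℤ) be the induced ring homomorphism τ ⊗ id. Let Ψ_p : R ⊗_ℤ (ℤ/pℤ) → R ⊗_ℤ (ℤ/pℤ) be any ring homomorphism with Ψ_p(B(k) ⊗ 1) = B(pk) ⊗ 1 for all k ∈ ℕ. Then Ψ_p ∘ τ̄ = τ̄ ∘ Ψ_p. (The map τ is the composite S ∘ bar of the shift operator S(P) = P(x+1) and the involution bar(P) = P(−x); the statement says the Frobenius map commutes with S ∘ bar.) -/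
open Polynomial TensorProduct

noncomputable section

def bR (k : ℕ) : Rring := ⟨B k, fun n => ⟨n.choose k, by simp [B_eval]⟩⟩

theorem B_comp (k : ℕ) :
    (B k).comp (-1 - X) = (-1) ^ k * (B k).comp (X + C (k : ℚ)) := by
  have h : ∏ i ∈ Finset.range k, ((-1 - X : ℚ[X]) - C (i : ℚ))
      = (-1) ^ k * ∏ i ∈ Finset.range k, (X + C (k : ℚ) - C (i : ℚ)) := by
    rw [← Finset.prod_range_reflect (fun i : ℕ => (X + C (k : ℚ) - C (i : ℚ) : ℚ[X]))]
    have : ((-1 : ℚ[X])) ^ k = ∏ i ∈ Finset.range k, (-1 : ℚ[X]) := by simp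
    rw [this, ← Finset.prod_mul_distrib]
    refine Finset.prod_congr rfl fun i hi => ?_
    have hi' : i + 1 ≤ k := Finset.mem_range.mp hi
    rw [Nat.sub_sub, Nat.cast_sub (by omega)]
    simp only [map_sub, map_natCast]
    push_cast
    ring
  unfold B
  rw [mul_comp, mul_comp, C_comp, C_comp, prod_comp, prod_comp]
  simp only [sub_comp, X_comp, C_comp]
  rw [h]
  ring

def tR (k : ℕ) : Rring := ⟨(-1) ^ k * (B k).comp (X + C (k : ℚ)), fun n =>
  ⟨(-1) ^ k * (n + k).choose k, by
    have := B_eval k (n + k)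
    push_cast at this
    simp [eval_comp, this]⟩⟩

theorem tR_eval (k n : ℕ) :
    (tR k : ℚ[X]).eval (n : ℚ) = (((-1) ^ k * ((n + k).choose k : ℤ) : ℤ) : ℚ) := by
  have := B_eval k (n + k)
  push_cast at this
  simp [tR, eval_comp, this]

theorem interp (P : Rring) (d : ℕ) : ∃ a : ℕ → ℤ, ∀ n < d,
    (P : ℚ[X]).eval (n : ℚ) = ∑ k ∈ Finset.range d, (a k : ℚ) * (n.choose k : ℚ) := by
  induction d with
  | zero => exact ⟨0, by simp⟩
  | succ d ih =>
    obtain ⟨a, ha⟩ := ih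
    obtain ⟨z, hz⟩ := P.2 d
    refine ⟨Function.update a d (z - ∑ k ∈ Finset.range d, a k * (d.choose k : ℤ)), ?_⟩
    intro n hn
    have hs : ∑ k ∈ Finset.range d, ((Function.update a d
        (z - ∑ k ∈ Finset.range d, a k * (d.choose k : ℤ)) k : ℤ) : ℚ) * (n.choose k : ℚ)
        = ∑ k ∈ Finset.range d, (a k : ℚ) * (n.choose k : ℚ) := by
      refine Finset.sum_congr rfl fun k hk => ?_
      rw [Function.update_of_ne (by have := Finset.mem_range.mp hk; omega)]
    rw [Finset.sum_range_succ, hs, Function.update_self]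
    rcases Nat.lt_succ_iff_lt_or_eq.mp hn with h | h
    · rw [ha n h, Nat.choose_eq_zero_of_lt h]; simp
    · subst h
      rw [hz, Nat.choose_self]; push_cast; ring

theorem B_natDegree (k : ℕ) : (B k).natDegree ≤ k := by
  unfold B
  refine (natDegree_C_mul_le _ _).trans ?_
  refine (natDegree_prod_le _ _).trans ?_
  simp only [natDegree_X_sub_C]
  simp

theorem span_all (P : Rring) : P ∈ AddSubgroup.closure (Set.range bR) := by
  obtain ⟨a, ha⟩ := interp P ((P : ℚ[X]).natDegree + 1)
  set d := (P : ℚ[X]).natDegree with hd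
  have : P = ∑ k ∈ Finset.range (d + 1), a k • bR k := by
    apply Subtype.ext
    have hc : ((∑ k ∈ Finset.range (d + 1), a k • bR k : Rring) : ℚ[X])
        = ∑ k ∈ Finset.range (d + 1), C (a k : ℚ) * B k := by
      rw [AddSubmonoidClass.coe_finsetSum]
      refine Finset.sum_congr rfl fun k _ => ?_
      simp [bR, zsmul_eq_mul]
    rw [hc]
    refine eq_of_natDegree_lt_card_of_eval_eq (ι := Fin (d + 1)) _ _
      (f := fun i => ((i : ℕ) : ℚ)) ?_ ?_ ?_
    · intro i j h
      have h' : ((i : ℕ) : ℚ) = ((j : ℕ) : ℚ) := h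
      exact Fin.ext (by exact_mod_cast h')
    · intro i
      rw [ha i i.2, eval_finsetSum]
      simp [B_eval]
    · rw [Fintype.card_fin, ← hd, Nat.lt_succ_iff]
      refine max_le le_rfl ?_
      refine natDegree_sum_le_of_forall_le _ _ fun k hk => ?_
      refine (natDegree_C_mul_le _ _).trans ((B_natDegree k).trans ?_)
      exact Nat.lt_succ_iff.mp (Finset.mem_range.mp hk)
  rw [this]
  exact AddSubgroup.sum_mem _ fun k _ => AddSubgroup.zsmul_mem _
    (AddSubgroup.subset_closure (Set.mem_range_self k)) _

theorem tmul_eq (p : ℕ) (hp : p ≠ 0) (P Q : Rring)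
    (h : ∀ n : ℕ, ∃ z : ℤ, (P : ℚ[X]).eval (n : ℚ) - (Q : ℚ[X]).eval (n : ℚ) = p * z) :
    P ⊗ₜ[ℤ] (1 : ZMod p) = Q ⊗ₜ[ℤ] (1 : ZMod p) := by
  have hp' : (p : ℚ) ≠ 0 := by exact_mod_cast hp
  let S : Rring := ⟨C (p : ℚ)⁻¹ * ((P : ℚ[X]) - Q), fun n => by
    obtain ⟨z, hz⟩ := h n
    exact ⟨z, by rw [eval_mul, eval_C, eval_sub, hz]; field_simp⟩⟩
  have hS : P = Q + (p : ℤ) • S := by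
    apply Subtype.ext
    have : C (p : ℚ) * C (p : ℚ)⁻¹ = 1 := by rw [← C_mul, mul_inv_cancel₀ hp', C_1]
    have h2 : (((p : ℤ) • S : Rring) : ℚ[X]) = C (p : ℚ) * (C (p : ℚ)⁻¹ * ((P : ℚ[X]) - Q)) := by
      simp [S, zsmul_eq_mul]
    rw [Subring.coe_add, h2, ← mul_assoc, this]
    ring
  rw [hS, TensorProduct.add_tmul, TensorProduct.smul_tmul]
  simp

theorem key (p : ℕ) (hp : p.Prime)
    (Ψ : (↥Rring ⊗[ℤ] ZMod p) →+* (↥Rring ⊗[ℤ] ZMod p))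
    (hΨ : ∀ (k : ℕ) (Bk Bpk : ↥Rring), (Bk : ℚ[X]) = B k → (Bpk : ℚ[X]) = B (p * k) →
      Ψ (Bk ⊗ₜ[ℤ] (1 : ZMod p)) = Bpk ⊗ₜ[ℤ] (1 : ZMod p)) (P : Rring) :
    ∃ Q : Rring, Ψ (P ⊗ₜ[ℤ] (1 : ZMod p)) = Q ⊗ₜ[ℤ] (1 : ZMod p) ∧
      ∀ n : ℕ, ∃ z : ℤ, (Q : ℚ[X]).eval (n : ℚ) - (P : ℚ[X]).eval ((n / p : ℕ) : ℚ) = p * z := by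
  have := Fact.mk hp
  induction span_all P using AddSubgroup.closure_induction with
  | mem x hx =>
    obtain ⟨k, rfl⟩ := hx
    refine ⟨bR (p * k), hΨ k _ _ rfl rfl, fun n => ?_⟩
    have h := Choose.choose_modEq_choose_mod_mul_choose_div_nat (p := p) (n := n) (k := p * k)
    rw [Nat.mul_mod_right, Nat.mul_div_cancel_left _ hp.pos, Nat.choose_zero_right, one_mul] at h
    obtain ⟨z, hz⟩ := (Nat.modEq_iff_dvd.mp h.symm)
    refine ⟨z, ?_⟩
    simp only [bR, B_eval]
    exact_mod_cast hz
  | zero => exact ⟨0, by simp, fun n => ⟨0, by simp⟩⟩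
  | add x y _ _ hx hy =>
    obtain ⟨Q, h1, h2⟩ := hx
    obtain ⟨Q', h1', h2'⟩ := hy
    refine ⟨Q + Q', by rw [TensorProduct.add_tmul, map_add, h1, h1', TensorProduct.add_tmul],
      fun n => ?_⟩
    obtain ⟨z, hz⟩ := h2 n
    obtain ⟨z', hz'⟩ := h2' n
    refine ⟨z + z', ?_⟩
    simp only [Subring.coe_add, eval_add]
    push_cast
    linear_combination hz + hz'
  | neg x _ hx =>
    obtain ⟨Q, h1, h2⟩ := hx
    refine ⟨-Q, by rw [TensorProduct.neg_tmul, map_neg, h1, TensorProduct.neg_tmul],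
      fun n => ?_⟩
    obtain ⟨z, hz⟩ := h2 n
    refine ⟨-z, ?_⟩
    simp only [Subring.coe_neg, eval_neg]
    push_cast
    linear_combination -hz

theorem exists_tmul_one (p : ℕ) (x : ↥Rring ⊗[ℤ] ZMod p) :
    ∃ P : Rring, x = P ⊗ₜ[ℤ] (1 : ZMod p) := by
  induction x using TensorProduct.induction_on with
  | zero => exact ⟨0, by simp⟩
  | tmul P c =>
    obtain ⟨z, rfl⟩ := ZMod.intCast_surjective c
    refine ⟨z • P, ?_⟩
    rw [TensorProduct.smul_tmul]
    simp
  | add x y hx hy =>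
    obtain ⟨P, rfl⟩ := hx
    obtain ⟨Q, rfl⟩ := hy
    exact ⟨P + Q, (TensorProduct.add_tmul _ _ _).symm⟩

/-- The Frobenius map `Ψ_p` on `R ⊗_ℤ ℤ/pℤ` (i.e. any ring homomorphism with
`Ψ_p(B(k) ⊗ 1) = B(pk) ⊗ 1`) commutes with the base change `τ̄ = τ ⊗ id` of the ring
endomorphism `τ : R → R`, `τ(P) = P∘(−1−x)` (which is `S ∘ bar`, the shift composed with
the involution `x ↦ −x`). -/
theorem frobenius_comm_shift_bar (p : ℕ) (hp : p.Prime)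
    (τbar Ψ : (↥Rring ⊗[ℤ] ZMod p) →+* (↥Rring ⊗[ℤ] ZMod p))
    (hτ₁ : ∀ c : ZMod p, τbar ((1 : ↥Rring) ⊗ₜ[ℤ] c) = (1 : ↥Rring) ⊗ₜ[ℤ] c)
    (hτ₂ : ∀ P Q : ↥Rring, (Q : ℚ[X]) = (P : ℚ[X]).comp (-1 - X) →
      τbar (P ⊗ₜ[ℤ] (1 : ZMod p)) = Q ⊗ₜ[ℤ] (1 : ZMod p))
    (hΨ : ∀ (k : ℕ) (Bk Bpk : ↥Rring), (Bk : ℚ[X]) = B k → (Bpk : ℚ[X]) = B (p * k) →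
      Ψ (Bk ⊗ₜ[ℤ] (1 : ZMod p)) = Bpk ⊗ₜ[ℤ] (1 : ZMod p)) :
    Ψ.comp τbar = τbar.comp Ψ := by
  have := Fact.mk hp
  refine RingHom.ext fun x => ?_
  obtain ⟨P, rfl⟩ := exists_tmul_one p x
  simp only [RingHom.comp_apply]
  induction span_all P using AddSubgroup.closure_induction with
  | mem x hx =>
    obtain ⟨k, rfl⟩ := hx
    rw [hτ₂ (bR k) (tR k) (B_comp k).symm, hΨ k (bR k) (bR (p * k)) rfl rfl,
      hτ₂ (bR (p * k)) (tR (p * k)) (B_comp (p * k)).symm]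
    obtain ⟨Q, hQ, hQ'⟩ := key p hp Ψ hΨ (tR k)
    rw [hQ]
    refine tmul_eq p hp.ne_zero _ _ fun n => ?_
    obtain ⟨z, hz⟩ := hQ' n
    have h := Choose.choose_modEq_choose_mod_mul_choose_div_nat (p := p) (n := n + p * k)
      (k := p * k)
    rw [Nat.mul_mod_right, Nat.mul_div_cancel_left _ hp.pos, Nat.choose_zero_right, one_mul,
      Nat.add_mul_div_left _ _ hp.pos] at h
    have h1 : (((-1) ^ k * ((n / p + k).choose k : ℤ) : ℤ) : ZMod p)
        = (((-1) ^ (p * k) * ((n + p * k).choose (p * k) : ℤ) : ℤ) : ZMod p) := by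
      have h2 := (ZMod.natCast_eq_natCast_iff _ _ _).mpr h
      push_cast
      rw [h2, pow_mul, ZMod.pow_card]
    obtain ⟨w, hw⟩ := (ZMod.intCast_eq_intCast_iff_dvd_sub _ _ _).mp h1.symm
    refine ⟨z + w, ?_⟩
    rw [tR_eval] at hz ⊢
    have hw' := congrArg (Int.cast : ℤ → ℚ) hw
    rw [Int.cast_sub, Int.cast_mul] at hw'
    push_cast at hz hw' ⊢
    linear_combination hz + hw'
  | zero => simp
  | add x y _ _ hx hy => simp only [TensorProduct.add_tmul, map_add, hx, hy]
  | neg x _ hx => simp only [TensorProduct.neg_tmul, map_neg, hx]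
end
end

section
/- Let k be a field of characteristic p > 0 and let φ : R → k be any ring homomorphism from the ring of integer-valued polynomials to k. Then the image of φ is contained in the prime subfield 𝔽_p of k; equivalently, φ(P)^p = φ(P) for every P ∈ R. -/
open Polynomial

noncomputable section

/-- Any ring homomorphism from the ring of integer-valued polynomials into a field `k` of
characteristic `p > 0` has image contained in the prime subfield `𝔽_p` of `k`;
equivalently, `φ(P)^p = φ(P)` for every `P ∈ R`. -/
theorem map_to_field_char_p_lands_in_prime_subfield (k : Type) [Field k] (p : ℕ)
    (hp : p.Prime) [CharP k p] (φ : ↥Rring →+* k) :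
    ∀ P : ↥Rring, φ P ∈ Set.range (ZMod.castHom (dvd_refl p) k) ∧ φ P ^ p = φ P := by
  have : Fact p.Prime := ⟨hp⟩
  intro P
  have hp0 : (p : ℚ) ≠ 0 := by exact_mod_cast hp.ne_zero
  have hQ : C ((p : ℚ)⁻¹) * ((P : ℚ[X]) ^ p - (P : ℚ[X])) ∈ Rring := by
    intro n
    obtain ⟨z, hz⟩ := P.2 n
    have hd : (p : ℤ) ∣ z ^ p - z := by
      rw [← ZMod.intCast_zmod_eq_zero_iff_dvd]
      push_cast
      rw [ZMod.pow_card, sub_self]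
    obtain ⟨w, hw⟩ := hd
    refine ⟨w, ?_⟩
    have hw' : (z : ℚ) ^ p - z = p * w := by exact_mod_cast hw
    simp only [eval_mul, eval_C, eval_sub, eval_pow, hz]
    rw [hw', inv_mul_cancel_left₀ hp0]
  have hR : P ^ p - P = (p : Rring) * ⟨_, hQ⟩ := by
    apply Subtype.ext
    push_cast
    rw [← mul_assoc, ← C_eq_natCast, ← C_mul, mul_inv_cancel₀ hp0, C_1, one_mul]
  have h := congrArg φ hR
  rw [map_sub, map_pow, map_mul, map_natCast, CharP.cast_eq_zero, zero_mul, sub_eq_zero] at h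
  refine ⟨?_, h⟩
  have h2 : φ P ∈ (⊥ : Subfield k) := (Subfield.mem_bot_iff_pow_eq_self k p).2 h
  rw [← ZMod.fieldRange_castHom_eq_bot p] at h2
  exact h2
end
end
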